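/- The symmetric box category □_S is thick: if f ∈ □_S factors uniquely as f = φ∘ψ with φ ∈ □ and ψ cotransverse, then ψ is a composite of symmetry maps, hence ψ ∈ □_S. -/

import Mathlib

open scoped ENNReal

open Classical in
noncomputable def dCube {n : ℕ} (x y : Fin n → Bool) : ℝ≥0∞ :=
  if x ≤ y then ((Finset.univ.filter fun i => x i ≠ y i).card : ℝ≥0∞) else ⊤

/-- Maps between binary cubes. -/
abbrev CubeMap (m n : ℕ) := (Fin m → Bool) → (Fin n → Bool)

/-- Cotransverse maps: strictly increasing poset maps preserving `d̄₁`-distance `1`. -/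
def Cotransverse {m n : ℕ} (f : CubeMap m n) : Prop :=
  StrictMono f ∧ ∀ x y, dCube x y = 1 → dCube (f x) (f y) = 1

/-- Membership in the box category `□`: composites of coface maps. -/
inductive IsBox : ∀ {m n : ℕ}, CubeMap m n → Prop
  | id (n : ℕ) : IsBox (@id (Fin n → Bool))
  | coface {n : ℕ} (i : Fin (n + 1)) (a : Bool) :
      IsBox (fun x : Fin n → Bool => (i.insertNth a x : Fin (n + 1) → Bool))
  | comp {m n p : ℕ} {f : CubeMap m n} {g : CubeMap n p} :
      IsBox f → IsBox g → IsBox (g ∘ f)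

/-- The symmetry map swapping coordinates `i` and `i+1`. -/
def symMap {n : ℕ} (i : Fin n) : CubeMap (n + 1) (n + 1) :=
  fun x => x ∘ (Equiv.swap i.castSucc i.succ)

/-- Membership in the symmetric box category `□_S`:
composites of coface maps and symmetry maps. -/
inductive IsBoxS : ∀ {m n : ℕ}, CubeMap m n → Prop
  | id (n : ℕ) : IsBoxS (@id (Fin n → Bool))
  | coface {n : ℕ} (i : Fin (n + 1)) (a : Bool) :
      IsBoxS (fun x : Fin n → Bool => (i.insertNth a x : Fin (n + 1) → Bool))
  | sym {n : ℕ} (i : Fin n) : IsBoxS (symMap i)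
  | comp {m n p : ℕ} {f : CubeMap m n} {g : CubeMap n p} :
      IsBoxS f → IsBoxS g → IsBoxS (g ∘ f)

/-- Composites of symmetry maps. -/
inductive IsSymComp : ∀ {n : ℕ}, CubeMap n n → Prop
  | id (n : ℕ) : IsSymComp (@id (Fin n → Bool))
  | sym {n : ℕ} (i : Fin n) : IsSymComp (symMap i)
  | comp {n : ℕ} {f g : CubeMap n n} :
      IsSymComp f → IsSymComp g → IsSymComp (g ∘ f)

/-- A cube map each of whose output coordinates is either constant or an input coordinate, such
that every input coordinate occurs. -/
def IsCoordinateMap {m n : ℕ} (f : CubeMap m n) : Prop :=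
  ∃ g : Fin n → Bool ⊕ Fin m,
    (∀ x j, f x j = Sum.elim id x (g j)) ∧ ∀ i, ∃ j, g j = Sum.inr i

theorem IsCoordinateMap.comp {m n p : ℕ} {f : CubeMap m n} {g : CubeMap n p}
    (hf : IsCoordinateMap f) (hg : IsCoordinateMap g) : IsCoordinateMap (g ∘ f) := by
  obtain ⟨u, hu, hu'⟩ := hf
  obtain ⟨v, hv, hv'⟩ := hg
  refine ⟨fun j => Sum.elim Sum.inl u (v j), fun x j => ?_, fun i => ?_⟩
  · rw [Function.comp_apply, hv]
    cases hj : v j <;> simp [hu, hj]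
  · obtain ⟨k, hk⟩ := hu' i
    obtain ⟨j, hj⟩ := hv' k
    exact ⟨j, by simp [hj, hk]⟩

theorem IsBoxS.isCoordinateMap {m n : ℕ} {f : CubeMap m n} (hf : IsBoxS f) :
    IsCoordinateMap f := by
  induction hf with
  | id n => exact ⟨Sum.inr, fun _ _ => rfl, fun i => ⟨i, rfl⟩⟩
  | @coface n i a =>
    refine ⟨i.insertNth (Sum.inl a) Sum.inr, fun x j => ?_, fun k => ⟨i.succAbove k, by simp⟩⟩
    cases j using i.succAboveCases <;> simp
  | sym i =>
    exact ⟨fun j => Sum.inr (Equiv.swap i.castSucc i.succ j), fun _ _ => rfl,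
      fun k => ⟨Equiv.swap i.castSucc i.succ k, by simp⟩⟩
  | comp _ _ ihf ihg => exact ihf.comp ihg

theorem IsBox.isBoxS {m n : ℕ} {f : CubeMap m n} (hf : IsBox f) : IsBoxS f := by
  induction hf with
  | id n => exact .id n
  | coface i a => exact .coface i a
  | comp _ _ ihf ihg => exact ihf.comp ihg

theorem IsSymComp.isBoxS {n : ℕ} {f : CubeMap n n} (hf : IsSymComp f) : IsBoxS f := by
  induction hf with
  | id n => exact .id n
  | sym i => exact .sym i
  | comp _ _ ihf ihg => exact ihf.comp ihg

/-- Every coordinate permutation is a composite of symmetry maps. -/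
theorem isSymComp_comp_perm {n : ℕ} (e : Equiv.Perm (Fin n)) :
    IsSymComp (fun x : Fin n → Bool => x ∘ e) := by
  cases n with
  | zero =>
    convert IsSymComp.id 0 using 1
  | succ n =>
    have he : e ∈ Submonoid.closure
        (Set.range fun i : Fin n => Equiv.swap i.castSucc i.succ) := by
      rw [Equiv.Perm.mclosure_swap_castSucc_succ]
      trivial
    induction he using Submonoid.closure_induction with
    | mem e he =>
      obtain ⟨i, rfl⟩ := he
      exact .sym i
    | one => exact .id _
    | mul a b _ _ iha ihb => exact iha.comp ihb

/-- If `φ` is a coordinate map, the coordinates of `ψ` can be read off from those of `φ ∘ ψ`. -/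
theorem exists_coordinates_of_comp {l m n : ℕ} {ψ : CubeMap l m} {φ : CubeMap m n}
    (hφ : IsCoordinateMap φ) (h : IsCoordinateMap (φ ∘ ψ)) :
    ∃ g : Fin m → Bool ⊕ Fin l, ∀ x i, ψ x i = Sum.elim id x (g i) := by
  obtain ⟨u, hu, -⟩ := h
  obtain ⟨v, hv, hv'⟩ := hφ
  choose s hs using hv'
  refine ⟨u ∘ s, fun x i => ?_⟩
  rw [Function.comp_apply, ← hu, Function.comp_apply, hv, hs, Sum.elim_inr]

/-- A strictly increasing endomap whose output coordinates are constants or input coordinates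
is a coordinate permutation. -/
theorem StrictMono.exists_perm_of_coordinates {m : ℕ} {ψ : CubeMap m m} (hψ : StrictMono ψ)
    {g : Fin m → Bool ⊕ Fin m} (hg : ∀ x i, ψ x i = Sum.elim id x (g i)) :
    ∃ e : Equiv.Perm (Fin m), ψ = fun x => x ∘ e := by
  have hsurj : ∀ i, ∃ j, g j = Sum.inr i := by
    intro i
    by_contra! hi
    have hlt : (⊥ : Fin m → Bool) < Function.update ⊥ i true := by
      rw [lt_update_self_iff]
      exact Bool.false_lt_true
    refine (hψ hlt).ne (funext fun j => ?_)
    rw [hg, hg]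
    rcases hj : g j with c | k
    · rfl
    · have hk : k ≠ i := fun h => hi j (h ▸ hj)
      simp [hk]
  choose s hs using hsurj
  have hinj : Function.Injective s := fun a b hab =>
    Sum.inr_injective ((hs a).symm.trans (hab ▸ hs b))
  let e := Equiv.ofBijective s (Finite.injective_iff_bijective.mp hinj)
  refine ⟨e.symm, funext fun x => funext fun j => ?_⟩
  obtain ⟨i, rfl⟩ := e.surjective j
  have hi : g (e i) = Sum.inr i := hs i
  simp [hg, hi]

/-- The symmetric box category is thick: for `f ∈ □_S`, in any factorization
`f = φ ∘ ψ` with `φ ∈ □` and `ψ` a cotransverse endomap, `ψ` is a composite of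
symmetry maps, hence `ψ ∈ □_S`. -/
theorem stmt14 {m n : ℕ} (f : CubeMap m n) (ψ : CubeMap m m) (φ : CubeMap m n)
    (hf : IsBoxS f) (hψ : Cotransverse ψ) (hφ : IsBox φ) (hfac : f = φ ∘ ψ) :
    IsSymComp ψ ∧ IsBoxS ψ := by
  obtain ⟨g, hg⟩ := exists_coordinates_of_comp hφ.isBoxS.isCoordinateMap
    (hfac ▸ hf.isCoordinateMap)
  obtain ⟨e, rfl⟩ := hψ.1.exists_perm_of_coordinates hg
  exact ⟨isSymComp_comp_perm e, (isSymComp_comp_perm e).isBoxS⟩
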